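/- arXiv:2004.01843 — 5 statements merged into one kernel-verified Lean document; each statement's English description precedes it below -/
import Mathlib

section
/- Let (a_n)_{n≥0} be a sequence of nonnegative real numbers, let g_0 ≥ 0 be a nonnegative real number, and let μ : [0,∞) → [0,∞) be a nonnegative Lebesgue-integrable function (μ ∈ L^1(0,∞)). Let (g_n)_{n≥1} be a sequence of nonnegative measurable functions on [0,∞) satisfying, for every n ≥ 0 and every t ≥ 0, the iterative inequality g_{n+1}(t) ≤ a_n + ∫_0^t μ(t') g_n(t') dt' (where g_0 denotes the constant function with value g_0). Then for every n ≥ 0, sup_{t ∈ [0,∞)} g_{n+1}(t) ≤ Σ_{k=0}^{n} (a_{n-k} ‖μ‖_{L^1(0,∞)}^k) / k! + g_0 ‖μ‖_{L^1(0,∞)}^{n+1} / (n+1)!. -/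
open MeasureTheory

theorem AbsolutelyContinuousOnInterval.fun_pow {f : ℝ → ℝ} {a b : ℝ}
    (hf : AbsolutelyContinuousOnInterval f a b) (n : ℕ) :
    AbsolutelyContinuousOnInterval (fun x ↦ f x ^ n) a b := by
  induction n with
  | zero =>
    simpa using (contDiffOn_const (c := (1 : ℝ))).absolutelyContinuousOnInterval (a := a) (b := b)
  | succ n ih => simpa only [pow_succ] using ih.fun_mul hf

theorem IntervalIntegrable.mul_primitive_pow {f : ℝ → ℝ} {a b : ℝ}
    (hf : IntervalIntegrable f volume a b) (n : ℕ) :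
    IntervalIntegrable (fun x ↦ f x * (∫ s in a..x, f s) ^ n) volume a b :=
  hf.mul_continuousOn
    ((hf.absolutelyContinuousOnInterval_intervalIntegral Set.left_mem_uIcc).fun_pow n).continuousOn

theorem IntervalIntegrable.integral_mul_primitive_pow {f : ℝ → ℝ} {a b : ℝ}
    (hf : IntervalIntegrable f volume a b) (n : ℕ) :
    ∫ x in a..b, f x * (∫ s in a..x, f s) ^ n = (∫ x in a..b, f x) ^ (n + 1) / (n + 1) := by
  have hac := (hf.absolutelyContinuousOnInterval_intervalIntegral Set.left_mem_uIcc).fun_pow (n + 1)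
  have hftc := hac.integral_deriv_eq_sub
  have hderiv : ∫ x in a..b, deriv (fun x ↦ (∫ s in a..x, f s) ^ (n + 1)) x =
      ∫ x in a..b, (n + 1) * (f x * (∫ s in a..x, f s) ^ n) := by
    apply intervalIntegral.integral_congr_ae
    filter_upwards [hf.ae_hasDerivAt_integral] with x hx hxm
    rw [((hx (Set.uIoc_subset_uIcc hxm) a Set.left_mem_uIcc).fun_pow (n + 1)).deriv]
    push_cast
    ring
  rw [hderiv, intervalIntegral.integral_const_mul] at hftc
  simp only [intervalIntegral.integral_same, ne_eq, Nat.add_eq_zero_iff, one_ne_zero, and_false,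
    not_false_eq_true, zero_pow, sub_zero] at hftc
  rw [← hftc]
  field_simp

/-- Lemma 3.2: weighted iterative estimate. If nonnegative functions `g n` satisfy
`g (n+1) t ≤ a n + ∫_0^t μ g n`, with `g 0` the constant `g₀`, then
`sup_t g (n+1) t ≤ ∑_{k=0}^n a (n-k) ‖μ‖_{L¹(0,∞)}^k / k! + g₀ ‖μ‖_{L¹(0,∞)}^{n+1} / (n+1)!`. -/
theorem iterative_gronwall_estimate
    (a : ℕ → ℝ) (ha : ∀ n, 0 ≤ a n)
    (g₀ : ℝ) (hg₀ : 0 ≤ g₀)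
    (μ : ℝ → ℝ) (hμ0 : ∀ t, 0 ≤ t → 0 ≤ μ t)
    (hμint : IntegrableOn μ (Set.Ioi 0))
    (g : ℕ → ℝ → ℝ)
    (hgzero : ∀ t, g 0 t = g₀)
    (hgmeas : ∀ n, Measurable (g n))
    (hgnonneg : ∀ n t, 0 ≤ t → 0 ≤ g n t)
    (hgint : ∀ n t, 0 ≤ t → IntegrableOn (fun s => μ s * g n s) (Set.Ioc 0 t))
    (hiter : ∀ n : ℕ, ∀ t : ℝ, 0 ≤ t →
      g (n + 1) t ≤ a n + ∫ s in Set.Ioc 0 t, μ s * g n s) :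
    ∀ n : ℕ, ∀ t : ℝ, 0 ≤ t →
      g (n + 1) t ≤
        (∑ k ∈ Finset.range (n + 1),
          a (n - k) * (∫ s in Set.Ioi (0 : ℝ), μ s) ^ k / (Nat.factorial k)) +
        g₀ * (∫ s in Set.Ioi (0 : ℝ), μ s) ^ (n + 1) / (Nat.factorial (n + 1)) := by
  have hμt : ∀ t, 0 ≤ t → IntervalIntegrable μ volume 0 t := fun t ht ↦
    (intervalIntegrable_iff_integrableOn_Ioc_of_le ht).2
      (hμint.mono_set Set.Ioc_subset_Ioi_self)
  have hterm : ∀ (c : ℝ) (k : ℕ) (t : ℝ), 0 ≤ t →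
      IntervalIntegrable (fun s ↦ μ s * (c * (∫ r in 0..s, μ r) ^ k / k.factorial)) volume 0 t ∧
      ∫ s in 0..t, μ s * (c * (∫ r in 0..s, μ r) ^ k / k.factorial) =
        c * (∫ s in 0..t, μ s) ^ (k + 1) / (k + 1).factorial := by
    intro c k t ht
    have heq : (fun s ↦ μ s * (c * (∫ r in 0..s, μ r) ^ k / k.factorial)) =
        fun s ↦ c / k.factorial * (μ s * (∫ r in 0..s, μ r) ^ k) := by
      ext s
      ring
    rw [heq]
    refine ⟨((hμt t ht).mul_primitive_pow k).const_mul _, ?_⟩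
    rw [intervalIntegral.integral_const_mul, (hμt t ht).integral_mul_primitive_pow,
      Nat.factorial_succ]
    push_cast
    field_simp
  have hbound : ∀ (n : ℕ) (t : ℝ), 0 ≤ t → g n t ≤
      (∑ k ∈ Finset.range n, a (n - 1 - k) * (∫ s in 0..t, μ s) ^ k / k.factorial) +
        g₀ * (∫ s in 0..t, μ s) ^ n / n.factorial := by
    intro n
    induction n with
    | zero => simp [hgzero]
    | succ n ih =>
      intro t ht
      have hint : IntervalIntegrable (fun s ↦ ∑ k ∈ Finset.range n,
          μ s * (a (n - 1 - k) * (∫ r in 0..s, μ r) ^ k / k.factorial)) volume 0 t := by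
        have := IntervalIntegrable.sum (Finset.range n)
          (f := fun k s ↦ μ s * (a (n - 1 - k) * (∫ r in 0..s, μ r) ^ k / k.factorial))
          fun k _ ↦ (hterm (a (n - 1 - k)) k t ht).1
        simpa only [Finset.sum_fn] using this
      have hmono : ∫ s in 0..t, μ s * g n s ≤ ∫ s in 0..t,
          ((∑ k ∈ Finset.range n, μ s * (a (n - 1 - k) * (∫ r in 0..s, μ r) ^ k / k.factorial)) +
            μ s * (g₀ * (∫ r in 0..s, μ r) ^ n / n.factorial)) := by
        refine intervalIntegral.integral_mono_on ht
          ((intervalIntegrable_iff_integrableOn_Ioc_of_le ht).2 (hgint n t ht))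
          (hint.add (hterm g₀ n t ht).1) fun s hs ↦ ?_
        rw [← Finset.mul_sum, ← mul_add]
        exact mul_le_mul_of_nonneg_left (ih s hs.1) (hμ0 s hs.1)
      rw [intervalIntegral.integral_add hint (hterm g₀ n t ht).1,
        intervalIntegral.integral_finsetSum fun k _ ↦ (hterm _ k t ht).1, (hterm g₀ n t ht).2,
        Finset.sum_congr rfl fun k _ ↦ (hterm (a (n - 1 - k)) k t ht).2,
        intervalIntegral.integral_of_le ht] at hmono
      rw [Finset.sum_range_succ']
      have hstep := hiter n t ht
      simp only [Nat.add_sub_cancel, Nat.sub_zero, pow_zero, mul_one, Nat.factorial_zero,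
        Nat.cast_one, div_one]
      simp only [Nat.sub_sub, Nat.add_comm 1] at hmono
      linarith
  intro n t ht
  have hM0 : 0 ≤ ∫ s in 0..t, μ s :=
    intervalIntegral.integral_nonneg ht fun s hs ↦ hμ0 s hs.1
  have hM : ∫ s in 0..t, μ s ≤ ∫ s in Set.Ioi (0 : ℝ), μ s := by
    rw [intervalIntegral.integral_of_le ht]
    refine setIntegral_mono_set hμint ?_ Set.Ioc_subset_Ioi_self.eventuallyLE
    filter_upwards [ae_restrict_mem measurableSet_Ioi] with s hs
    exact hμ0 s (le_of_lt hs)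
  refine (hbound (n + 1) t ht).trans ?_
  rw [Nat.add_sub_cancel]
  gcongr with k
  exact ha (n - k)
end

section
/- Let λ > 0 and b, κ ∈ ℝ. Let v, ρ : [0, 1/λ) × ℝ → ℝ be smooth functions and set n = v − v_{xx} (second spatial derivative). Define u, σ : [0,∞) × ℝ → ℝ by u(t,x) = e^{−λt} v((1 − e^{−λt})/λ, x) and σ(t,x) = e^{−λt} ρ((1 − e^{−λt})/λ, x), and set m = u − u_{xx}. Then (u, σ) satisfies the weakly dissipative two-component b-family system m_t + u m_x + b u_x m + κ σ σ_x + λ m = 0 and σ_t + (u σ)_x + λ σ = 0 pointwise on (0,∞) × ℝ if and only if (v, ρ) satisfies the non-dissipative system n_t + v n_x + b v_x n + κ ρ ρ_x = 0 and ρ_t + (v ρ)_x = 0 pointwise on (0, 1/λ) × ℝ. -/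
/-- The partial derivative in the second variable of a smooth function is smooth. -/
theorem contDiff_uncurry_deriv {f : ℝ → ℝ → ℝ}
    (hf : ContDiff ℝ (⊤ : ℕ∞) (Function.uncurry f)) :
    ContDiff ℝ (⊤ : ℕ∞) (Function.uncurry fun t x => deriv (f t) x) := by
  have h : (Function.uncurry fun t x => deriv (f t) x) =
      fun p : ℝ × ℝ => fderiv ℝ (Function.uncurry f) p (0, 1) := by
    ext ⟨t, x⟩
    have hd : HasFDerivAt (Function.uncurry f) (fderiv ℝ (Function.uncurry f) (t, x)) (t, x) :=
      ((hf.differentiable (by simp)) (t, x)).hasFDerivAt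
    have hc : HasDerivAt (fun y : ℝ => (t, y)) ((0 : ℝ), (1 : ℝ)) x :=
      (hasDerivAt_const x t).prodMk (hasDerivAt_id x)
    exact (hd.comp_hasDerivAt x hc).deriv
  rw [h]
  exact (hf.fderiv_right (by simp)).clm_apply contDiff_const

/-- A smooth function of two variables is differentiable in the first one. -/
theorem differentiable_fst_of_contDiff_uncurry {f : ℝ → ℝ → ℝ}
    (hf : ContDiff ℝ (⊤ : ℕ∞) (Function.uncurry f)) (x : ℝ) :
    Differentiable ℝ fun t => f t x :=
  (hf.differentiable (by simp)).comp (differentiable_id.prodMk (differentiable_const x))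

/-- Time derivative of `e^{-λt} g((1-e^{-λt})/λ)`. -/
theorem deriv_exp_mul_comp_rescale {lam : ℝ} (hlam : lam ≠ 0) {g : ℝ → ℝ}
    (hg : Differentiable ℝ g) (t : ℝ) :
    deriv (fun s => Real.exp (-(lam * s)) * g ((1 - Real.exp (-(lam * s))) / lam)) t =
      Real.exp (-(lam * t)) ^ 2 * deriv g ((1 - Real.exp (-(lam * t))) / lam)
        - lam * (Real.exp (-(lam * t)) * g ((1 - Real.exp (-(lam * t))) / lam)) := by
  have hE : HasDerivAt (fun s : ℝ => Real.exp (-(lam * s)))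
      (Real.exp (-(lam * t)) * -(lam * 1)) t :=
    (((hasDerivAt_id t).const_mul lam).neg).exp
  have hT := (hE.const_sub 1).div_const lam
  have hG := (hg ((1 - Real.exp (-(lam * t))) / lam)).hasDerivAt.comp t hT
  refine (hE.mul hG).deriv.trans ?_
  simp only [Function.comp_apply]
  field_simp
  ring


/-- Lenells–Wunsch equivalence: with `u(t,x) = e^{-λt} v((1-e^{-λt})/λ, x)`,
`σ(t,x) = e^{-λt} ρ((1-e^{-λt})/λ, x)`, `m = u - u_{xx}`, `n = v - v_{xx}`, the pair `(u,σ)`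
solves the weakly dissipative two-component b-family system on `(0,∞) × ℝ` iff `(v,ρ)`
solves the non-dissipative system on `(0,1/λ) × ℝ`. -/
theorem damped_undamped_equivalence
    (lam b κ : ℝ) (hlam : 0 < lam)
    (v ρ : ℝ → ℝ → ℝ)
    (hv : ContDiff ℝ (⊤ : ℕ∞) (Function.uncurry v))
    (hρ : ContDiff ℝ (⊤ : ℕ∞) (Function.uncurry ρ))
    (n : ℝ → ℝ → ℝ)
    (hn : ∀ t x : ℝ, n t x = v t x - deriv (deriv (v t)) x)
    (u σ : ℝ → ℝ → ℝ)
    (hu : ∀ t x : ℝ, u t x = Real.exp (-(lam * t)) * v ((1 - Real.exp (-(lam * t))) / lam) x)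
    (hσ : ∀ t x : ℝ, σ t x = Real.exp (-(lam * t)) * ρ ((1 - Real.exp (-(lam * t))) / lam) x)
    (m : ℝ → ℝ → ℝ)
    (hm : ∀ t x : ℝ, m t x = u t x - deriv (deriv (u t)) x) :
    ((∀ t x : ℝ, 0 < t →
        deriv (fun s => m s x) t + u t x * deriv (m t) x + b * deriv (u t) x * m t x
            + κ * σ t x * deriv (σ t) x + lam * m t x = 0 ∧
        deriv (fun s => σ s x) t + deriv (fun y => u t y * σ t y) x + lam * σ t x = 0)
      ↔
      (∀ t x : ℝ, 0 < t → t < 1 / lam →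
        deriv (fun s => n s x) t + v t x * deriv (n t) x + b * deriv (v t) x * n t x
            + κ * ρ t x * deriv (ρ t) x = 0 ∧
        deriv (fun s => ρ s x) t + deriv (fun y => v t y * ρ t y) x = 0)) := by
  have hnd : ∀ x, Differentiable ℝ fun t => n t x := fun x => by
    simp only [hn]
    exact (differentiable_fst_of_contDiff_uncurry hv x).sub
      (differentiable_fst_of_contDiff_uncurry
        (contDiff_uncurry_deriv (contDiff_uncurry_deriv hv)) x)
  have hρd := differentiable_fst_of_contDiff_uncurry hρ
  have hux : ∀ t, deriv (u t) = fun x =>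
      Real.exp (-(lam * t)) * deriv (v ((1 - Real.exp (-(lam * t))) / lam)) x := fun t => by
    ext x
    rw [funext (hu t), deriv_const_mul_field]
  have hσx : ∀ t, deriv (σ t) = fun x =>
      Real.exp (-(lam * t)) * deriv (ρ ((1 - Real.exp (-(lam * t))) / lam)) x := fun t => by
    ext x
    rw [funext (hσ t), deriv_const_mul_field]
  have hmn : ∀ t x, m t x =
      Real.exp (-(lam * t)) * n ((1 - Real.exp (-(lam * t))) / lam) x := fun t x => by
    rw [hm, hux, deriv_const_mul_field, hu, hn]
    ring
  have hmx : ∀ t, deriv (m t) = fun x =>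
      Real.exp (-(lam * t)) * deriv (n ((1 - Real.exp (-(lam * t))) / lam)) x := fun t => by
    ext x
    rw [funext (hmn t), deriv_const_mul_field]
  have hmt : ∀ t x, deriv (fun s => m s x) t = _ := fun t x => by
    simp only [hmn]
    exact deriv_exp_mul_comp_rescale hlam.ne' (hnd x) t
  have hσt : ∀ t x, deriv (fun s => σ s x) t = _ := fun t x => by
    simp only [hσ]
    exact deriv_exp_mul_comp_rescale hlam.ne' (hρd x) t
  have huσ : ∀ t x, deriv (fun y => u t y * σ t y) x = Real.exp (-(lam * t)) ^ 2 *
      deriv (fun y => v ((1 - Real.exp (-(lam * t))) / lam) y *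
        ρ ((1 - Real.exp (-(lam * t))) / lam) y) x := fun t x => by
    rw [← deriv_const_mul_field]
    congr 1
    ext y
    rw [hu, hσ]
    ring
  have key : ∀ t x : ℝ,
      (deriv (fun s => m s x) t + u t x * deriv (m t) x + b * deriv (u t) x * m t x
            + κ * σ t x * deriv (σ t) x + lam * m t x = 0 ∧
        deriv (fun s => σ s x) t + deriv (fun y => u t y * σ t y) x + lam * σ t x = 0) ↔
      ∀ τ, τ = (1 - Real.exp (-(lam * t))) / lam →
        deriv (fun s => n s x) τ + v τ x * deriv (n τ) x + b * deriv (v τ) x * n τ x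
            + κ * ρ τ x * deriv (ρ τ) x = 0 ∧
        deriv (fun s => ρ s x) τ + deriv (fun y => v τ y * ρ τ y) x = 0 := fun t x => by
    have hE2 : Real.exp (-(lam * t)) ^ 2 ≠ 0 := by positivity
    rw [forall_eq, hmt, hσt, huσ, hmx, hux, hσx, hmn, hu, hσ]
    refine and_congr ?_ ?_ <;>
    · conv_rhs => rw [← mul_eq_zero_iff_left hE2]
      ring_nf
  constructor
  · intro h t x ht ht'
    have hpos : 0 < 1 - lam * t := by
      rw [lt_div_iff₀ hlam] at ht'
      linarith
    refine (key (-Real.log (1 - lam * t) / lam) x).1 (h _ x ?_) t ?_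
    · refine div_pos (neg_pos.2 (Real.log_neg hpos ?_)) hlam
      linarith [mul_pos hlam ht]
    · rw [mul_div_cancel₀ _ hlam.ne', neg_neg, Real.exp_log hpos]
      field_simp
      ring
  · intro h t x ht
    refine (key t x).2 ?_
    rintro τ rfl
    refine h _ x (div_pos ?_ hlam) (div_lt_div_of_pos_right ?_ hlam)
    · have := Real.exp_lt_one_iff.2 (neg_lt_zero.2 (mul_pos hlam ht))
      linarith
    · linarith [Real.exp_pos (-(lam * t))]
end

section
/- Let T ∈ (0,∞], let ξ : [0,T) → ℝ be continuous, let u : [0,T) × ℝ → ℝ be continuously differentiable, and let ψ : [0,T) × ℝ → ℝ be twice continuously differentiable and satisfy ψ(0,x) = x and ∂_t ψ(t,x) = ξ(t) u(t, ψ(t,x)) for all (t,x). Let σ : [0,T) × ℝ → ℝ be continuously differentiable and satisfy ∂_t σ + ξ(t) u ∂_x σ + ξ(t) σ ∂_x u = 0 pointwise on [0,T) × ℝ. Suppose that σ(0,·) is bounded, that for each s ∈ [0,T) the function y ↦ ξ(s)(∂_x u)(s,y) is bounded below, that the function s ↦ inf_{y∈ℝ} ξ(s)(∂_x u)(s,y)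 is integrable on [0,t] for each t ∈ [0,T), and that ψ(t,·) : ℝ → ℝ is surjective for each t. Then for every t ∈ [0,T), sup_{x∈ℝ} |σ(t,x)| ≤ ( sup_{x∈ℝ} |σ(0,x)| ) · exp( − ∫_0^t inf_{y∈ℝ} { ξ(s)(∂_x u)(s,y) } ds ). -/
open MeasureTheory ENNReal

/-- The partial derivative of a differentiable function in its first variable. -/
theorem hasDerivAt_fst_of_uncurry {f : ℝ → ℝ → ℝ} {t x : ℝ}
    (hf : DifferentiableAt ℝ (Function.uncurry f) (t, x)) :
    HasDerivAt (fun s => f s x) (fderiv ℝ (Function.uncurry f) (t, x) (1, 0)) t :=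
  HasFDerivAt.comp_hasDerivAt (f := fun s : ℝ => (s, x)) t hf.hasFDerivAt
    ((hasDerivAt_id t).prodMk (hasDerivAt_const t x))

/-- The partial derivative of a differentiable function in its second variable. -/
theorem hasDerivAt_snd_of_uncurry {f : ℝ → ℝ → ℝ} {t x : ℝ}
    (hf : DifferentiableAt ℝ (Function.uncurry f) (t, x)) :
    HasDerivAt (f t) (fderiv ℝ (Function.uncurry f) (t, x) (0, 1)) x :=
  HasFDerivAt.comp_hasDerivAt (f := fun y : ℝ => (t, y)) x hf.hasFDerivAt
    ((hasDerivAt_const x t).prodMk (hasDerivAt_id x))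

/-- The chain rule along a curve, in terms of partial derivatives. -/
theorem hasDerivAt_uncurry_curve {f : ℝ → ℝ → ℝ} {c : ℝ → ℝ} {c' t : ℝ}
    (hf : DifferentiableAt ℝ (Function.uncurry f) (t, c t)) (hc : HasDerivAt c c' t) :
    HasDerivAt (fun s => f s (c s))
      (deriv (fun s => f s (c t)) t + c' * deriv (f t) (c t)) t := by
  rw [(hasDerivAt_fst_of_uncurry hf).deriv, (hasDerivAt_snd_of_uncurry hf).deriv]
  have h := HasFDerivAt.comp_hasDerivAt (f := fun s : ℝ => (s, c s)) t hf.hasFDerivAt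
    ((hasDerivAt_id t).prodMk hc)
  have hsplit : ((1 : ℝ), c') = (1, 0) + c' • ((0 : ℝ), (1 : ℝ)) := by simp
  rw [hsplit, map_add, map_smul, smul_eq_mul] at h
  exact h

/-- A solution of `g' = -a g` on `[0, t]` is `g 0 * exp (-∫ a)`. -/
theorem eq_mul_exp_neg_integral {g a : ℝ → ℝ} {t : ℝ} (ht : 0 ≤ t) (ha : Continuous a)
    (hg : ∀ s ∈ Set.Icc 0 t, HasDerivAt g (-(a s * g s)) s) :
    g t = g 0 * Real.exp (-∫ s in (0 : ℝ)..t, a s) := by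
  have hderiv : ∀ s ∈ Set.Icc 0 t,
      HasDerivAt (fun r => g r * Real.exp (∫ q in (0 : ℝ)..r, a q)) 0 s := fun s hs => by
    have h := (hg s hs).mul (ha.integral_hasStrictDerivAt 0 s).hasDerivAt.exp
    exact h.congr_deriv (by ring)
  have hconst := constant_of_has_deriv_right_zero
    (fun s hs => (hderiv s hs).continuousAt.continuousWithinAt)
    (fun s hs => (hderiv s (Set.Ico_subset_Icc_self hs)).hasDerivWithinAt)
    t (Set.right_mem_Icc.2 ht)
  simp only [intervalIntegral.integral_same, Real.exp_zero, mul_one] at hconst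
  rw [← hconst, mul_assoc, ← Real.exp_add, add_neg_cancel, Real.exp_zero, mul_one]

/-- The `L^∞` bound for the transport equation: `‖σ(t)‖_{L^∞} ≤ ‖σ(0)‖_{L^∞}
· exp(-∫_0^t inf_y {ξ(s) u_x(s,y)} ds)`. -/
theorem transport_Linfty_bound
    (T : ℝ≥0∞) (hT : 0 < T)
    (ξ : ℝ → ℝ) (hξ : Continuous ξ)
    (u : ℝ → ℝ → ℝ) (hu : ContDiff ℝ 1 (Function.uncurry u))
    (ψ : ℝ → ℝ → ℝ) (hψ : ContDiff ℝ 2 (Function.uncurry ψ))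
    (hψ0 : ∀ x : ℝ, ψ 0 x = x)
    (hψode : ∀ t x : ℝ, 0 ≤ t → ENNReal.ofReal t < T →
      deriv (fun s => ψ s x) t = ξ t * u t (ψ t x))
    (σ : ℝ → ℝ → ℝ) (hσ : ContDiff ℝ 1 (Function.uncurry σ))
    (hσpde : ∀ t x : ℝ, 0 ≤ t → ENNReal.ofReal t < T →
      deriv (fun s => σ s x) t + ξ t * u t x * deriv (σ t) x
        + ξ t * σ t x * deriv (u t) x = 0)
    (hσ0bdd : BddAbove (Set.range fun x : ℝ => |σ 0 x|))
    (hbdd : ∀ s : ℝ, 0 ≤ s → ENNReal.ofReal s < T →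
      BddBelow (Set.range fun y : ℝ => ξ s * deriv (u s) y))
    (hint : ∀ t : ℝ, 0 ≤ t → ENNReal.ofReal t < T →
      IntegrableOn (fun s : ℝ => ⨅ y : ℝ, ξ s * deriv (u s) y) (Set.Ioc 0 t))
    (hsurj : ∀ t : ℝ, 0 ≤ t → ENNReal.ofReal t < T → Function.Surjective (ψ t)) :
    ∀ t : ℝ, 0 ≤ t → ENNReal.ofReal t < T →
      ∀ x : ℝ, |σ t x| ≤
        (⨆ x' : ℝ, |σ 0 x'|) *
          Real.exp (-∫ s in (0 : ℝ)..t, ⨅ y : ℝ, ξ s * deriv (u s) y) := by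
  intro t ht htT x
  obtain ⟨y, rfl⟩ := hsurj t ht htT x
  have hlt : ∀ s ∈ Set.Icc 0 t, ENNReal.ofReal s < T := fun s hs =>
    (ENNReal.ofReal_le_ofReal hs.2).trans_lt htT
  have hcurve : ∀ s, HasDerivAt (fun r => ψ r y) (deriv (fun r => ψ r y) s) s := fun s =>
    (hasDerivAt_fst_of_uncurry
      (hψ.differentiable (by norm_num) (s, y))).differentiableAt.hasDerivAt
  have hcont : Continuous fun s => ξ s * deriv (u s) (ψ s y) := by
    have hux : ∀ s, deriv (u s) (ψ s y) =
        fderiv ℝ (Function.uncurry u) (s, ψ s y) (0, 1) := fun s =>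
      (hasDerivAt_snd_of_uncurry (hu.differentiable one_ne_zero _)).deriv
    have hψc : Continuous fun s => ψ s y :=
      continuous_iff_continuousAt.2 fun s => (hcurve s).continuousAt
    simp only [hux]
    exact hξ.mul (((hu.continuous_fderiv one_ne_zero).comp
      (continuous_id.prodMk hψc)).clm_apply continuous_const)
  have hsol := eq_mul_exp_neg_integral (g := fun s => σ s (ψ s y)) ht hcont fun s hs => by
    refine (hasDerivAt_uncurry_curve (hσ.differentiable one_ne_zero _)
      (hcurve s)).congr_deriv ?_
    rw [hψode s y hs.1 (hlt s hs)]
    linear_combination hσpde s (ψ s y) hs.1 (hlt s hs)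
  have hint_le : (∫ s in (0 : ℝ)..t, ⨅ z : ℝ, ξ s * deriv (u s) z) ≤
      ∫ s in (0 : ℝ)..t, ξ s * deriv (u s) (ψ s y) :=
    intervalIntegral.integral_mono_on ht
      ((intervalIntegrable_iff_integrableOn_Ioc_of_le ht).2 (hint t ht htT))
      (hcont.intervalIntegrable 0 t)
      fun s hs => ciInf_le (hbdd s hs.1 (hlt s hs)) (ψ s y)
  simp only [hψ0] at hsol
  rw [hsol, abs_mul, Real.abs_exp]
  have hinit : |σ 0 y| ≤ ⨆ x' : ℝ, |σ 0 x'| := le_ciSup hσ0bdd y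
  exact mul_le_mul hinit (Real.exp_le_exp.2 (neg_le_neg hint_le)) (Real.exp_pos _).le
    ((abs_nonneg _).trans hinit)
end

section
/- Let p : ℝ → ℝ be defined by p(x) = (1/2) e^{−|x|}. For every Schwartz function f : ℝ → ℝ, the convolution g = p * f (i.e., g(x) = ∫_ℝ p(x−y) f(y) dy) is twice continuously differentiable and satisfies g(x) − g''(x) = f(x) for every x ∈ ℝ. -/
open MeasureTheory

open Set in
theorem hasDerivAt_integral_Iic {h : ℝ → ℝ} (hc : Continuous h)
    (hi : ∀ x, IntegrableOn h (Iic x)) (x : ℝ) :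
    HasDerivAt (fun x => ∫ y in Iic x, h y) (h x) x := by
  have key : (fun x => ∫ y in Iic x, h y) =
      fun x => (∫ y in Iic 0, h y) + ∫ y in (0 : ℝ)..x, h y := by
    funext x
    rw [← intervalIntegral.integral_Iic_sub_Iic (hi 0) (hi x)]
    ring
  rw [key]
  exact (hc.integral_hasStrictDerivAt 0 x).hasDerivAt.const_add _

open Set in
theorem hasDerivAt_integral_Ioi {h : ℝ → ℝ} (hc : Continuous h)
    (hi : ∀ x, IntegrableOn h (Ioi x)) (x : ℝ) :
    HasDerivAt (fun x => ∫ y in Ioi x, h y) (-h x) x := by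
  have key : (fun x => ∫ y in Ioi x, h y) =
      fun x => (∫ y in Ioi 0, h y) - ∫ y in (0 : ℝ)..x, h y := by
    funext x
    rw [← intervalIntegral.integral_Ioi_sub_Ioi' (hi 0) (hi x)]
    ring
  rw [key]
  exact (hc.integral_hasStrictDerivAt 0 x).hasDerivAt.const_sub _

theorem integrableOn_Iic_exp_mul {φ : ℝ → ℝ} (hφ : Integrable φ) (x : ℝ) :
    IntegrableOn (fun y => Real.exp y * φ y) (Set.Iic x) := by
  refine hφ.integrableOn.bdd_mul (c := Real.exp x) (by fun_prop) ?_
  filter_upwards [ae_restrict_mem measurableSet_Iic] with y hy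
  rw [Real.norm_eq_abs, Real.abs_exp]
  exact Real.exp_le_exp.2 hy

theorem integrableOn_Ioi_exp_neg_mul {φ : ℝ → ℝ} (hφ : Integrable φ) (x : ℝ) :
    IntegrableOn (fun y => Real.exp (-y) * φ y) (Set.Ioi x) := by
  refine hφ.integrableOn.bdd_mul (c := Real.exp (-x)) (by fun_prop) ?_
  filter_upwards [ae_restrict_mem measurableSet_Ioi] with y hy
  rw [Real.norm_eq_abs, Real.abs_exp]
  exact Real.exp_le_exp.2 (neg_le_neg (le_of_lt hy))

open Set in
/-- The convolution with the Green's function splits into its two one-sided parts. -/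
theorem integral_exp_neg_abs_sub_mul {φ : ℝ → ℝ} (hφ : Integrable φ) (x : ℝ) :
    ∫ y : ℝ, (1 / 2) * Real.exp (-|x - y|) * φ y =
      (1 / 2) * (Real.exp (-x) * (∫ y in Iic x, Real.exp y * φ y) +
        Real.exp x * ∫ y in Ioi x, Real.exp (-y) * φ y) := by
  have hint : Integrable fun y : ℝ => (1 / 2) * Real.exp (-|x - y|) * φ y := by
    refine hφ.bdd_mul (c := 1 / 2) (by fun_prop) (Filter.Eventually.of_forall fun y => ?_)
    rw [norm_mul, Real.norm_eq_abs, Real.norm_eq_abs, Real.abs_exp,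
      abs_of_pos (by norm_num : (0 : ℝ) < 1 / 2)]
    have : Real.exp (-|x - y|) ≤ 1 := Real.exp_le_one_iff.2 (by simp)
    linarith
  rw [← intervalIntegral.integral_Iic_add_Ioi (b := x) hint.integrableOn hint.integrableOn,
    mul_add, ← mul_assoc, ← mul_assoc, ← integral_const_mul, ← integral_const_mul]
  congr 1
  · refine setIntegral_congr_fun measurableSet_Iic fun y hy => ?_
    have hy : y ≤ x := hy
    simp only [abs_of_nonneg (sub_nonneg.2 hy)]
    rw [show -(x - y) = -x + y by ring, Real.exp_add]
    ring
  · refine setIntegral_congr_fun measurableSet_Ioi fun y hy => ?_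
    have hy : x < y := hy
    simp only [abs_of_neg (sub_neg.2 hy)]
    rw [show - -(x - y) = x + -y by ring, Real.exp_add]
    ring

/-- `p(x) = (1/2) e^{-|x|}` is the Green's function of `1 - ∂_x²`: for every Schwartz
function `f`, the convolution `g = p * f` is `C²` and satisfies `g - g'' = f`. -/
theorem green_function_one_sub_dxx (f : SchwartzMap ℝ ℝ) (g : ℝ → ℝ)
    (hg : ∀ x : ℝ, g x = ∫ y : ℝ, (1 / 2) * Real.exp (-|x - y|) * f y) :
    ContDiff ℝ 2 g ∧ ∀ x : ℝ, g x - deriv (deriv g) x = f x := by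
  have hφ : Integrable f := f.integrable
  have hf : Continuous f := f.continuous
  set A : ℝ → ℝ := fun x => ∫ y in Set.Iic x, Real.exp y * f y
  set B : ℝ → ℝ := fun x => ∫ y in Set.Ioi x, Real.exp (-y) * f y
  have hA : ∀ x, HasDerivAt A (Real.exp x * f x) x :=
    hasDerivAt_integral_Iic (by fun_prop) (integrableOn_Iic_exp_mul hφ)
  have hB : ∀ x, HasDerivAt B (-(Real.exp (-x) * f x)) x :=
    hasDerivAt_integral_Ioi (by fun_prop) (integrableOn_Ioi_exp_neg_mul hφ)
  have hgAB : g = fun x => (1 / 2) * (Real.exp (-x) * A x + Real.exp x * B x) :=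
    funext fun x => (hg x).trans (integral_exp_neg_abs_sub_mul hφ x)
  have hE : ∀ x : ℝ, HasDerivAt (fun x => Real.exp (-x)) (-Real.exp (-x)) x := fun x => by
    simpa using (hasDerivAt_neg x).exp
  have hEE : ∀ x : ℝ, Real.exp (-x) * Real.exp x = 1 := fun x => by
    rw [← Real.exp_add, neg_add_cancel, Real.exp_zero]
  have hg1 : ∀ x, HasDerivAt g ((1 / 2) * (Real.exp x * B x - Real.exp (-x) * A x)) x :=
      fun x => by
    rw [hgAB]
    refine ((((hE x).mul (hA x)).add ((Real.hasDerivAt_exp x).mul (hB x))).const_mul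
      (1 / 2)).congr_deriv ?_
    ring
  have hdg : deriv g = fun x => (1 / 2) * (Real.exp x * B x - Real.exp (-x) * A x) :=
    funext fun x => (hg1 x).deriv
  have hg2 : ∀ x, HasDerivAt (deriv g) (g x - f x) x := fun x => by
    rw [hdg, hgAB]
    refine ((((Real.hasDerivAt_exp x).mul (hB x)).sub ((hE x).mul (hA x))).const_mul
      (1 / 2)).congr_deriv ?_
    linear_combination -f x * hEE x
  have hddg : deriv (deriv g) = fun x => g x - f x := funext fun x => (hg2 x).deriv
  have hgd : Differentiable ℝ g := fun x => (hg1 x).differentiableAt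
  refine ⟨?_, fun x => by rw [hddg]; ring⟩
  rw [show (2 : WithTop ℕ∞) = 1 + 1 by norm_num, contDiff_succ_iff_deriv]
  refine ⟨hgd, by simp, ?_⟩
  rw [contDiff_one_iff_deriv, hddg]
  exact ⟨fun x => (hg2 x).differentiableAt, hgd.continuous.sub hf⟩
end

section
/- Let v : ℝ → ℝ be a Schwartz function, and define u = 4v − v'' and m = u − u''. Then ∫_ℝ [ (u·m)'(x) + 2 u'(x) m(x) ] v(x) dx = 0. -/
open MeasureTheory

open scoped SchwartzMap

/-- The integral over `ℝ` of the derivative of a Schwartz function vanishes. -/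
lemma SchwartzMap.integral_deriv_eq_zero (f : 𝓢(ℝ, ℝ)) : ∫ x, deriv f x = 0 :=
  integral_eq_zero_of_hasDerivAt_of_integrable f.hasDerivAt
    (SchwartzMap.derivCLM ℝ ℝ f).integrable f.integrable

/-- The Degasperis–Procesi-type cancellation: for a Schwartz function `v`, with
`u = 4v - v''` and `m = u - u''`, one has `∫ ((u m)' + 2 u' m) v dx = 0`. -/
theorem degasperis_procesi_cancellation
    (v : SchwartzMap ℝ ℝ) (u m : ℝ → ℝ)
    (hu : ∀ x : ℝ, u x = 4 * v x - deriv (deriv (⇑v)) x)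
    (hm : ∀ x : ℝ, m x = u x - deriv (deriv u) x) :
    ∫ x : ℝ, (deriv (fun y => u y * m y) x + 2 * deriv u x * m x) * v x = 0 := by
  let D := SchwartzMap.derivCLM ℝ ℝ
  have hD (f : 𝓢(ℝ, ℝ)) : deriv f = D f := rfl
  have hd (f : 𝓢(ℝ, ℝ)) (x : ℝ) : HasDerivAt f (D f x) x := f.hasDerivAt x
  obtain ⟨U, rfl⟩ : ∃ U : 𝓢(ℝ, ℝ), u = U :=
    ⟨(4 : ℝ) • v - D (D v), funext fun x => by simp [hu, hD]⟩
  obtain ⟨M, rfl⟩ : ∃ M : 𝓢(ℝ, ℝ), m = M :=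
    ⟨U - D (D U), funext fun x => by simp [hm, hD]⟩
  simp only [hD] at hu hm
  have hU' (x : ℝ) : D U x = 4 * D v x - D (D (D v)) x :=
    (hd U x).unique ((((hd v x).const_mul 4).sub (hd (D (D v)) x)).congr_of_eventuallyEq
      (.of_forall hu))
  let P (f g : 𝓢(ℝ, ℝ)) : 𝓢(ℝ, ℝ) := SchwartzMap.pairing (ContinuousLinearMap.mul ℝ ℝ) f g
  have hP (f g : 𝓢(ℝ, ℝ)) (x : ℝ) : P f g x = f x * g x := rfl
  -- an explicit primitive of the integrand
  let F : 𝓢(ℝ, ℝ) := P (P U M) v + P (P U U) v - P (P (D U) (D U)) v + P (P U (D U)) (D v)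
    - (1 / 2 : ℝ) • P (P U U) (D (D v)) - (1 / 6 : ℝ) • P (P U U) U
  have hF : (F : ℝ → ℝ) = fun x => U x * M x * v x + U x * U x * v x - D U x * D U x * v x
      + U x * D U x * D v x - 1 / 2 * (U x * U x * D (D v) x) - 1 / 6 * (U x * U x * U x) := by
    funext x
    simp [F, hP]
  rw [← F.integral_deriv_eq_zero]
  congr 1
  funext x
  have hUM := (hd U x).mul (hd M x)
  have hUU := (hd U x).mul (hd U x)
  have hFx := (((((hUM.mul (hd v x)).add (hUU.mul (hd v x))).sub
    (((hd (D U) x).mul (hd (D U) x)).mul (hd v x))).add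
    (((hd U x).mul (hd (D U) x)).mul (hd (D v) x))).sub
    ((hUU.mul (hd (D (D v)) x)).const_mul (1 / 2))).sub ((hUU.mul (hd U x)).const_mul (1 / 6))
  have hderivF := (hFx.congr_of_eventuallyEq (.of_forall (congrFun hF))).deriv
  have hderivUM : deriv (fun y => U y * M y) x = D U x * M x + U x * D M x := hUM.deriv
  rw [hderivF, hderivUM, hD]
  simp only [Pi.mul_apply]
  linear_combination (2 * D U x * v x - U x * D v x) * hm x + (U x ^ 2 / 2) * hU' x
end
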